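/- Assume τ_k^{s,t} ≠ 0, τ_k^{s,t+1} ≠ 0 and σ_k^{s,t} ≠ 0 for all k. Then for every n ≥ 1 the polynomial identity P_n^{s,t+1}(x) + d_n^{s,t} P_{n−1}^{s,t+1}(x) = P_n^{s,t}(x) + e_n^{s,t} P_{n−1}^{s,t}(x) holds, where d_n^{s,t} = −σ_n^{s,t}τ_{n−1}^{s,t+1}/(σ_{n−1}^{s,t}τ_n^{s,t+1}) and e_n^{s,t} = −σ_n^{s,t}τ_{n−1}^{s,t}/(σ_{n−1}^{s,t}τ_n^{s,t}). -/

import Mathlib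

open MeasureTheory

/-- Bimoments `m_{i,j}^{s,t}` of the Cauchy-Jacobi weight. -/
noncomputable def mom (s t i j : ℕ) : ℝ :=
  ∫ p in (Set.Ioo (0:ℝ) 1 ×ˢ Set.Ioo (0:ℝ) 1),
    (p.1 ^ (s + i) * p.2 ^ (s + j) / (p.1 + p.2)) *
      ((1 - p.1) / (1 + p.1)) ^ t * ((1 - p.2) / (1 + p.2)) ^ t

/-- Single moments `φ_i^{s,t} = L_{s,t}(x^i)`. -/
noncomputable def phi (s t i : ℕ) : ℝ :=
  Real.sqrt 2 * ∫ x in Set.Ioo (0:ℝ) 1,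
    (x ^ (s + i) / (1 + x)) * ((1 - x) / (1 + x)) ^ t

/-- Single moments `m_i^{s,t}`. -/
noncomputable def momS (s t i : ℕ) : ℝ :=
  ∫ x in Set.Ioo (0:ℝ) 1, x ^ (s + i) * ((1 - x) / (1 + x)) ^ t

/-- `τ_n^{s,t} = det(m_{i,j}^{s,t})_{i,j=0}^{n-1}` (with `τ_0^{s,t} = 1`). -/
noncomputable def tau (s t n : ℕ) : ℝ :=
  Matrix.det (Matrix.of fun i j : Fin n => mom s t i j)

/-- `ξ_n^{s,t} = det(m_{i,j+1}^{s,t})_{i,j=0}^{n-1}` (with `ξ_0^{s,t} = 1`). -/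
noncomputable def xi (s t n : ℕ) : ℝ :=
  Matrix.det (Matrix.of fun i j : Fin n => mom s t i ((j : ℕ) + 1))

/-- `σ_n^{s,t}`: determinant of the `(n+1)×(n+1)` matrix with first `n` columns the
bimoments and last column `(φ_0^{s,t},…,φ_n^{s,t})`. -/
noncomputable def sig (s t n : ℕ) : ℝ :=
  Matrix.det (Matrix.of fun i j : Fin (n + 1) =>
    if (j : ℕ) < n then mom s t i j else phi s t i)

/-- `ψ_n^{s,t}`: like `σ_n^{s,t}` but with shifted bimoments `m_{i,j+1}^{s,t}`. -/
noncomputable def psi (s t n : ℕ) : ℝ :=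
  Matrix.det (Matrix.of fun i j : Fin (n + 1) =>
    if (j : ℕ) < n then mom s t i ((j : ℕ) + 1) else phi s t i)

/-- `σ̃_n^{s,t}`: determinant of the `(n+1)×(n+1)` matrix with first `n` columns the
bimoments and last column the single moments `(m_0^{s,t},…,m_n^{s,t})`. -/
noncomputable def sigT (s t n : ℕ) : ℝ :=
  Matrix.det (Matrix.of fun i j : Fin (n + 1) =>
    if (j : ℕ) < n then mom s t i j else momS s t i)

/-- `τ̃_n^{s,t}`: determinant of the `n×n` matrix whose rows are the bimoment rows
`i = 0,…,n−2,n`. -/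
noncomputable def tauT (s t n : ℕ) : ℝ :=
  Matrix.det (Matrix.of fun i j : Fin n =>
    mom s t (if (i : ℕ) < n - 1 then (i : ℕ) else n) j)

/-- The monic Cauchy-Jacobi orthogonal polynomial `P_n^{s,t}` (as a real function). -/
noncomputable def P (s t n : ℕ) (x : ℝ) : ℝ :=
  (1 / tau s t n) * Matrix.det (Matrix.of fun i j : Fin (n + 1) =>
    if (j : ℕ) < n then mom s t i j else x ^ (i : ℕ))

/-- The adjacent monic polynomial `Q_n^{s,t}` (as a real function). -/
noncomputable def Q (s t n : ℕ) (x : ℝ) : ℝ :=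
  (1 / xi s t n) * Matrix.det (Matrix.of fun i j : Fin (n + 1) =>
    if (j : ℕ) < n then mom s t i ((j : ℕ) + 1) else x ^ (i : ℕ))

/-- The auxiliary monic polynomial `R_n^{s,t}` (as a real function): first column
`(φ_0,…,φ_n)`, next `n−1` columns the bimoments `m_{i,j}` for `j = 0,…,n−2`,
last column `(1,x,…,x^n)`, normalized by `(−1)^{n−1}/σ_{n−1}^{s,t}`. -/
noncomputable def R (s t n : ℕ) (x : ℝ) : ℝ :=
  ((-1 : ℝ) ^ (n - 1) / sig s t (n - 1)) *
    Matrix.det (Matrix.of fun i j : Fin (n + 1) =>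
      if (j : ℕ) = 0 then phi s t i
      else if (j : ℕ) < n then mom s t i ((j : ℕ) - 1) else x ^ (i : ℕ))

/-- The two-parameter deformed Cauchy inner product `⟨f,g⟩_{s,t}` on real functions. -/
noncomputable def innerF (s t : ℕ) (f g : ℝ → ℝ) : ℝ :=
  ∫ p in (Set.Ioo (0:ℝ) 1 ×ˢ Set.Ioo (0:ℝ) 1),
    (p.1 ^ s * p.2 ^ s / (p.1 + p.2)) * f p.1 * g p.2 *
      ((1 - p.1) / (1 + p.1)) ^ t * ((1 - p.2) / (1 + p.2)) ^ t

/-- The two-parameter deformed Cauchy inner product on real polynomials. -/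
noncomputable def innerP (s t : ℕ) (f g : Polynomial ℝ) : ℝ :=
  innerF s t (fun x => f.eval x) (fun y => g.eval y)

/-- The linear functional `L_{s,t}` on real functions. -/
noncomputable def LF (s t : ℕ) (f : ℝ → ℝ) : ℝ :=
  Real.sqrt 2 * ∫ x in Set.Ioo (0:ℝ) 1,
    (x ^ s / (1 + x)) * f x * ((1 - x) / (1 + x)) ^ t

/-- The linear functional `L_{s,t}` on real polynomials. -/
noncomputable def LP (s t : ℕ) (f : Polynomial ℝ) : ℝ := LF s t (fun x => f.eval x)

/-- The determinant of order `n + 1` whose first `n` columns are those of `A` and whose last column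
is `u`. -/
noncomputable def borderedDet (A : ℕ → ℕ → ℝ) (n : ℕ) (u : ℕ → ℝ) : ℝ :=
  Matrix.det (Matrix.of fun i j : Fin (n + 1) => if (j : ℕ) < n then A i j else u i)

theorem exists_borderedDet_eq_sum (A : ℕ → ℕ → ℝ) (n : ℕ) :
    ∃ c : ℕ → ℝ, c n = Matrix.det (Matrix.of fun i j : Fin n => A i j) ∧
      ∀ u, borderedDet A n u = ∑ i ∈ Finset.range (n + 1), c i * u i := by
  refine ⟨fun i => if h : i < n + 1 then (-1) ^ (i + n) * Matrix.det
    (Matrix.of fun k l : Fin n => A ((⟨i, h⟩ : Fin (n + 1)).succAbove k) l) else 0, ?_, fun u => ?_⟩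
  · have h : (⟨n, n.lt_succ_self⟩ : Fin (n + 1)) = Fin.last n := rfl
    simp [h, ← two_mul]
  · rw [borderedDet, Matrix.det_succ_column _ (Fin.last n), ← Fin.sum_univ_eq_sum_range
      (fun i => (if h : i < n + 1 then (-1) ^ (i + n) * Matrix.det (Matrix.of fun k l : Fin n =>
        A ((⟨i, h⟩ : Fin (n + 1)).succAbove k) l) else 0) * u i)]
    refine Finset.sum_congr rfl fun i _ => ?_
    have h : Matrix.submatrix (Matrix.of fun i j : Fin (n + 1) =>
        if (j : ℕ) < n then A i j else u i) i.succAbove (Fin.last n).succAbove =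
        Matrix.of fun k l : Fin n => A (i.succAbove k) l := by
      ext k l
      simp
    rw [h, dif_pos i.isLt]
    simp only [Matrix.of_apply, Fin.val_last, lt_irrefl, if_false]
    ring

theorem borderedDet_col (A : ℕ → ℕ → ℝ) {n j : ℕ} (hj : j < n) :
    borderedDet A n (fun i => A i j) = 0 := by
  refine Matrix.det_zero_of_column_eq (i := ⟨j, by omega⟩) (j := Fin.last n) ?_ fun k => ?_
  · simp [Fin.ext_iff, hj.ne]
  · simp [hj]

theorem borderedDet_add_mul (A : ℕ → ℕ → ℝ) (n : ℕ) (a : ℝ) (u v : ℕ → ℝ) :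
    borderedDet A n (fun i => u i + a * v i) = borderedDet A n u + a * borderedDet A n v := by
  obtain ⟨c, -, hc⟩ := exists_borderedDet_eq_sum A n
  simp only [hc, Finset.mul_sum, ← Finset.sum_add_distrib]
  exact Finset.sum_congr rfl fun i _ => by ring

/-- Subtracting multiples of the last column from the others leaves the determinant unchanged. -/
theorem borderedDet_eq_of_sub {A B : ℕ → ℕ → ℝ} {u v : ℕ → ℝ}
    (h : ∀ i j, B i j = A i j - u i * v j) (n : ℕ) : borderedDet B n u = borderedDet A n u := by
  rw [borderedDet, borderedDet, ← Matrix.det_transpose, ← Matrix.det_transpose (Matrix.of _)]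
  refine Matrix.det_eq_of_forall_row_eq_smul_add_const
    (fun j : Fin (n + 1) => if (j : ℕ) < n then -v j else 0) (Fin.last n) (by simp) fun j i => ?_
  by_cases hj : (j : ℕ) < n <;> simp [hj, h]
  ring

/-- A linear functional supported on the first `n + 2` coordinates vanishes as soon as it kills the
last one, the first `n` columns of `A` and the column `v`. -/
theorem sum_mul_eq_zero_of_borderedDet_ne_zero {A : ℕ → ℕ → ℝ} {n : ℕ} {v c : ℕ → ℝ}
    (hdet : borderedDet A n v ≠ 0) (hlast : c (n + 1) = 0)
    (hcol : ∀ j < n, ∑ i ∈ Finset.range (n + 2), c i * A i j = 0)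
    (hv : ∑ i ∈ Finset.range (n + 2), c i * v i = 0) (w : ℕ → ℝ) :
    ∑ i ∈ Finset.range (n + 2), c i * w i = 0 := by
  simp only [Finset.sum_range_succ _ (n + 1), hlast, zero_mul, add_zero] at *
  have hc : (fun i : Fin (n + 1) => c i) = 0 := by
    refine Matrix.eq_zero_of_vecMul_eq_zero hdet ?_
    ext j
    simp only [Matrix.vecMul, dotProduct, Matrix.of_apply, Pi.zero_apply]
    by_cases hj : (j : ℕ) < n
    · simpa [hj] using (Fin.sum_univ_eq_sum_range (fun i => c i * A i j) (n + 1)).trans (hcol j hj)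
    · simpa [hj] using (Fin.sum_univ_eq_sum_range (fun i => c i * v i) (n + 1)).trans hv
  refine Finset.sum_eq_zero fun i hi => ?_
  have : c i = 0 := congrFun hc ⟨i, Finset.mem_range.1 hi⟩
  simp [this]

theorem borderedDet_relation {A B : ℕ → ℕ → ℝ} {v : ℕ → ℝ} (hAB : ∀ i j, B i j = A i j - v i * v j)
    (n : ℕ) {a b a' b' : ℝ}
    (ha : a ≠ 0) (hb : b ≠ 0) (ha' : a' ≠ 0) (hb' : b' ≠ 0) (hσ : borderedDet A n v ≠ 0)
    (hA : Matrix.det (Matrix.of fun i j : Fin (n + 1) => A i j) = a)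
    (hB : Matrix.det (Matrix.of fun i j : Fin (n + 1) => B i j) = b) (w : ℕ → ℝ) :
    1 / b * borderedDet B (n + 1) w +
        (-(borderedDet A (n + 1) v * b') / (borderedDet A n v * b)) *
          (1 / b' * borderedDet B n w) =
      1 / a * borderedDet A (n + 1) w +
        (-(borderedDet A (n + 1) v * a') / (borderedDet A n v * a)) *
          (1 / a' * borderedDet A n w) := by
  obtain ⟨c₁, h₁, hc₁⟩ := exists_borderedDet_eq_sum B (n + 1)
  obtain ⟨c₂, -, hc₂⟩ := exists_borderedDet_eq_sum B n
  obtain ⟨c₃, h₃, hc₃⟩ := exists_borderedDet_eq_sum A (n + 1)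
  obtain ⟨c₄, -, hc₄⟩ := exists_borderedDet_eq_sum A n
  set σ := borderedDet A n v with hσ_def
  set ρ := borderedDet A (n + 1) v with hρ_def
  have hBv : borderedDet B n v = σ := borderedDet_eq_of_sub hAB n
  have hBv' : borderedDet B (n + 1) v = ρ := borderedDet_eq_of_sub hAB (n + 1)
  let c : ℕ → ℝ := fun i => c₁ i / b - ρ / (σ * b) * (if i < n + 1 then c₂ i else 0) -
    (c₃ i / a - ρ / (σ * a) * (if i < n + 1 then c₄ i else 0))
  have hc : ∀ u : ℕ → ℝ, ∑ i ∈ Finset.range (n + 2), c i * u i =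
      borderedDet B (n + 1) u / b - ρ / (σ * b) * borderedDet B n u -
        (borderedDet A (n + 1) u / a - ρ / (σ * a) * borderedDet A n u) := by
    intro u
    have trunc : ∀ d : ℕ → ℝ, ∑ i ∈ Finset.range (n + 1), d i * u i =
        ∑ i ∈ Finset.range (n + 2), (if i < n + 1 then d i else 0) * u i := by
      intro d
      rw [Finset.sum_range_succ _ (n + 1)]
      simp only [lt_irrefl, if_false, zero_mul, add_zero]
      exact Finset.sum_congr rfl fun i hi => by rw [if_pos (Finset.mem_range.1 hi)]
    rw [hc₁, hc₂, hc₃, hc₄, trunc c₂, trunc c₄]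
    simp only [Finset.sum_div, Finset.mul_sum, ← Finset.sum_sub_distrib]
    exact Finset.sum_congr rfl fun i _ => by simp only [c]; ring
  have hBcol : ∀ j k, j < k → borderedDet B k (fun i => A i j) = v j * borderedDet B k v := by
    intro j k hjk
    have : (fun i => A i j) = fun i => B i j + v j * v i := by
      ext i
      rw [hAB]
      ring
    rw [this, borderedDet_add_mul, borderedDet_col B hjk, zero_add]
  have key := sum_mul_eq_zero_of_borderedDet_ne_zero (c := c) hσ
    (by simp [c, h₁, h₃, hA, hB, ha, hb])
    (fun j hj => by
      rw [hc, hBcol j _ hj, hBcol j _ (by omega), borderedDet_col A hj,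
        borderedDet_col A (hj.trans n.lt_succ_self), hBv, hBv']
      field_simp
      ring)
    (by
      rw [hc, hBv, hBv', ← hσ_def, ← hρ_def]
      field_simp
      ring) w
  rw [hc] at key
  field_simp at key ⊢
  linarith

theorem jacobiWeight_mem_Icc {x : ℝ} (hx : x ∈ Set.Ioo (0 : ℝ) 1) (t : ℕ) :
    ((1 - x) / (1 + x)) ^ t ∈ Set.Icc (0 : ℝ) 1 := by
  have h0 : 0 ≤ (1 - x) / (1 + x) := div_nonneg (by linarith [hx.2]) (by linarith [hx.1])
  have h1 : (1 - x) / (1 + x) ≤ 1 := by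
    rw [div_le_one (by linarith [hx.1])]
    linarith [hx.1]
  exact ⟨pow_nonneg h0 t, pow_le_one₀ h0 h1⟩

theorem integrableOn_phi (s t i : ℕ) :
    IntegrableOn (fun x : ℝ => (x ^ (s + i) / (1 + x)) * ((1 - x) / (1 + x)) ^ t)
      (Set.Ioo 0 1) := by
  refine Measure.integrableOn_of_bounded (M := 1) (by simp) (by fun_prop) ?_
  refine (ae_restrict_iff' measurableSet_Ioo).2 (.of_forall fun x hx => ?_)
  obtain ⟨h0, h1⟩ := jacobiWeight_mem_Icc hx t
  have hp : x ^ (s + i) ≤ 1 := pow_le_one₀ hx.1.le hx.2.le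
  have hp0 : 0 ≤ x ^ (s + i) := pow_nonneg hx.1.le _
  have hq0 : 0 ≤ x ^ (s + i) / (1 + x) := div_nonneg hp0 (by linarith [hx.1])
  have hq : x ^ (s + i) / (1 + x) ≤ 1 := by
    rw [div_le_one (by linarith [hx.1])]
    linarith [hx.1]
  rw [Real.norm_of_nonneg (mul_nonneg hq0 h0)]
  exact mul_le_one₀ hq h0 h1

theorem integrableOn_inv_add :
    IntegrableOn (fun p : ℝ × ℝ => (p.1 + p.2)⁻¹) (Set.Ioo 0 1 ×ˢ Set.Ioo 0 1) := by
  have h : IntegrableOn (fun x : ℝ => x ^ (-(1 / 2) : ℝ)) (Set.Ioo 0 1) :=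
    (intervalIntegral.integrableOn_Ioo_rpow_iff one_pos).2 (by norm_num)
  have hprod : IntegrableOn (fun p : ℝ × ℝ => p.1 ^ (-(1 / 2) : ℝ) * p.2 ^ (-(1 / 2) : ℝ))
      (Set.Ioo 0 1 ×ˢ Set.Ioo 0 1) := by
    rw [IntegrableOn, Measure.volume_eq_prod, ← Measure.prod_restrict]
    exact Integrable.mul_prod h h
  refine Integrable.mono' hprod (by fun_prop) ?_
  refine (ae_restrict_iff' (measurableSet_Ioo.prod measurableSet_Ioo)).2 (.of_forall ?_)
  rintro ⟨x, y⟩ ⟨⟨hx, -⟩, ⟨hy, -⟩⟩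
  simp only at hx hy ⊢
  rw [Real.norm_of_nonneg (by positivity), Real.rpow_neg hx.le, Real.rpow_neg hy.le,
    ← Real.sqrt_eq_rpow, ← Real.sqrt_eq_rpow, ← mul_inv]
  refine inv_anti₀ (by positivity) ?_
  nlinarith [Real.sq_sqrt hx.le, Real.sq_sqrt hy.le, sq_nonneg (√x - √y),
    mul_nonneg (Real.sqrt_nonneg x) (Real.sqrt_nonneg y)]

theorem integrableOn_mom (s t i j : ℕ) :
    IntegrableOn (fun p : ℝ × ℝ => (p.1 ^ (s + i) * p.2 ^ (s + j) / (p.1 + p.2)) *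
      ((1 - p.1) / (1 + p.1)) ^ t * ((1 - p.2) / (1 + p.2)) ^ t)
      (Set.Ioo 0 1 ×ˢ Set.Ioo 0 1) := by
  refine Integrable.mono' integrableOn_inv_add (by fun_prop) ?_
  refine (ae_restrict_iff' (measurableSet_Ioo.prod measurableSet_Ioo)).2 (.of_forall ?_)
  rintro ⟨x, y⟩ ⟨hx, hy⟩
  obtain ⟨hwx, hwx'⟩ := jacobiWeight_mem_Icc hx t
  obtain ⟨hwy, hwy'⟩ := jacobiWeight_mem_Icc hy t
  have hpx0 : 0 ≤ x ^ (s + i) := pow_nonneg hx.1.le _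
  have hpy0 : 0 ≤ y ^ (s + j) := pow_nonneg hy.1.le _
  have hpx : x ^ (s + i) ≤ 1 := pow_le_one₀ hx.1.le hx.2.le
  have hpy : y ^ (s + j) ≤ 1 := pow_le_one₀ hy.1.le hy.2.le
  have hinv : 0 ≤ (x + y)⁻¹ := inv_nonneg.2 (add_nonneg hx.1.le hy.1.le)
  simp only at *
  rw [div_eq_mul_inv, Real.norm_of_nonneg
    (mul_nonneg (mul_nonneg (mul_nonneg (mul_nonneg hpx0 hpy0) hinv) hwx) hwy)]
  calc _ = (x ^ (s + i) * y ^ (s + j) * ((1 - x) / (1 + x)) ^ t * ((1 - y) / (1 + y)) ^ t) *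
        (x + y)⁻¹ := by ring
    _ ≤ 1 * (x + y)⁻¹ := mul_le_mul_of_nonneg_right (mul_le_one₀ (mul_le_one₀
        (mul_le_one₀ hpx hpy0 hpy) hwx hwx') hwy hwy') hinv
    _ = (x + y)⁻¹ := one_mul _

/-- Raising `t` by one is a rank one modification of the bimoment matrix. -/
theorem mom_succ (s t i j : ℕ) : mom s (t + 1) i j = mom s t i j - phi s t i * phi s t j := by
  have hprod : phi s t i * phi s t j = ∫ p in (Set.Ioo (0:ℝ) 1 ×ˢ Set.Ioo (0:ℝ) 1),
      2 * (((p.1 ^ (s + i) / (1 + p.1)) * ((1 - p.1) / (1 + p.1)) ^ t) *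
        ((p.2 ^ (s + j) / (1 + p.2)) * ((1 - p.2) / (1 + p.2)) ^ t)) := by
    rw [integral_const_mul, Measure.volume_eq_prod, setIntegral_prod_mul
      (fun x : ℝ => (x ^ (s + i) / (1 + x)) * ((1 - x) / (1 + x)) ^ t)
      (fun x : ℝ => (x ^ (s + j) / (1 + x)) * ((1 - x) / (1 + x)) ^ t), phi, phi]
    rw [mul_mul_mul_comm, Real.mul_self_sqrt zero_le_two]
  have hint : IntegrableOn (fun p : ℝ × ℝ =>
      2 * (((p.1 ^ (s + i) / (1 + p.1)) * ((1 - p.1) / (1 + p.1)) ^ t) *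
        ((p.2 ^ (s + j) / (1 + p.2)) * ((1 - p.2) / (1 + p.2)) ^ t)))
      (Set.Ioo 0 1 ×ˢ Set.Ioo 0 1) := by
    rw [IntegrableOn, Measure.volume_eq_prod, ← Measure.prod_restrict]
    exact ((integrableOn_phi s t i).mul_prod (integrableOn_phi s t j)).const_mul 2
  rw [hprod, mom, mom, ← integral_sub (integrableOn_mom s t i j) hint]
  refine setIntegral_congr_fun (measurableSet_Ioo.prod measurableSet_Ioo) ?_
  rintro ⟨x, y⟩ ⟨⟨hx, -⟩, ⟨hy, -⟩⟩
  simp only at hx hy ⊢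
  rw [pow_succ, pow_succ]
  generalize ((1 - x) / (1 + x)) ^ t = a
  generalize ((1 - y) / (1 + y)) ^ t = b
  field_simp
  ring

/-- the discrete spectral transformation in the `t`-direction,
`P_n^{s,t+1} + d_n^{s,t}P_{n−1}^{s,t+1} = P_n^{s,t} + e_n^{s,t}P_{n−1}^{s,t}`. -/
theorem spectral_transformation_II (s t : ℕ)
    (h₁ : ∀ k, tau s t k ≠ 0) (h₂ : ∀ k, tau s (t + 1) k ≠ 0) (h₃ : ∀ k, sig s t k ≠ 0)
    (n : ℕ) (hn : 1 ≤ n) (x : ℝ) :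
    P s (t + 1) n x +
        (-(sig s t n * tau s (t + 1) (n - 1)) / (sig s t (n - 1) * tau s (t + 1) n)) *
          P s (t + 1) (n - 1) x =
      P s t n x +
        (-(sig s t n * tau s t (n - 1)) / (sig s t (n - 1) * tau s t n)) *
          P s t (n - 1) x := by
  obtain ⟨m, rfl⟩ := Nat.exists_eq_add_of_le' hn
  exact borderedDet_relation (mom_succ s t) m (h₁ _) (h₂ _) (h₁ _) (h₂ _) (h₃ _) rfl rfl
    fun i => x ^ i
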